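/- Let F be a field, n > d ≥ k ≥ 1, and x_1,…,x_n distinct elements of F; let ψ_i = (1, x_i, …, x_i^{d−1}) ∈ F^d be the i-th row of the n×d Vandermonde matrix Ψ. Let M be a symmetric d×d matrix over F whose bottom-right (d−k)×(d−k) block is zero (i.e., M_{ab} = 0 whenever a > k and b > k). If ψ_{i_1} M = ψ_{i_2} M = … = ψ_{i_k} M = 0 for some k distinct indices i_1,…,i_k, then M = 0. Consequently, the stored vectors ψ_{i_1} M, …, ψ_{i_k} M of any k nodes uniquely determine the message matrix M, i.e., any k nodes suffice to reconstruct the stored file. -/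

import Mathlib

/-- A vector whose entries vanish from position `k` on is zero as soon as the polynomial with
these coefficients vanishes at `k` distinct points. -/
theorem eq_zero_of_sum_pow_mul_eq_zero {R : Type*} [CommRing R] [IsDomain R] {d k : ℕ}
    (hkd : k ≤ d) {y : Fin k → R} (hy : Function.Injective y) {c : Fin d → R}
    (hc : ∀ a : Fin d, k ≤ (a : ℕ) → c a = 0)
    (h : ∀ t, ∑ a : Fin d, y t ^ (a : ℕ) * c a = 0) : c = 0 := by
  obtain ⟨m, rfl⟩ := Nat.exists_eq_add_of_le hkd
  have hhead : (fun a : Fin k => c (Fin.castAdd m a)) = 0 := by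
    refine Matrix.eq_zero_of_forall_index_sum_pow_mul_eq_zero hy fun t => ?_
    simpa [Fin.sum_univ_add, hc] using h t
  funext a
  induction a using Fin.addCases with
  | left a => exact congrFun hhead a
  | right a => exact hc _ (by simp)

/-- Let `F` be a field, `n > d ≥ k ≥ 1`, and `x 1, …, x n` distinct elements of
`F`; `ψ i = (1, x i, …, (x i)^(d-1))` is the `i`-th row of the `n × d` Vandermonde matrix.
Let `M` be a symmetric `d × d` matrix over `F` whose bottom-right `(d-k) × (d-k)` block is
zero (i.e., `M a b = 0` whenever both indices lie beyond the first `k` positions).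
If `ψ (i 1) * M = ⋯ = ψ (i k) * M = 0` for `k` distinct indices `i 1, …, i k`, then `M = 0`.
Consequently, the stored vectors of any `k` nodes uniquely determine the message matrix `M`,
i.e., any `k` nodes suffice to reconstruct the stored file. -/
theorem any_k_nodes_reconstruct
    (F : Type*) [Field F] (n d k : ℕ) (hk : 1 ≤ k) (hkd : k ≤ d) (hdn : d < n)
    (x : Fin n → F) (hx : Function.Injective x)
    (ψ : Fin n → Fin d → F) (hψ : ∀ i a, ψ i a = x i ^ (a : ℕ))
    (M : Matrix (Fin d) (Fin d) F) (hM : M.IsSymm)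
    (hblock : ∀ a b : Fin d, k ≤ (a : ℕ) → k ≤ (b : ℕ) → M a b = 0)
    (i : Fin k → Fin n) (hi : Function.Injective i)
    (hzero : ∀ t : Fin k, Matrix.vecMul (ψ (i t)) M = 0) :
    M = 0 := by
  have column (b : Fin d) (hb : ∀ a : Fin d, k ≤ (a : ℕ) → M a b = 0) (a : Fin d) :
      M a b = 0 :=
    congrFun (eq_zero_of_sum_pow_mul_eq_zero hkd (hx.comp hi) (c := fun a => M a b) hb
      fun t => by simpa [Matrix.vecMul, dotProduct, hψ] using congrFun (hzero t) b) a
  ext a b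
  refine column b (fun a ha => ?_) a
  rw [← hM.apply]
  exact column a (fun e he => hblock e a he ha) b
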